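/- Let Γ = {a,b,c} and let K ⊆ (Γ ∪ {0})* be the closure of the language Γ*0Γ*0 under the congruence generated by xxx = xx. Then K is not a regular language. -/

import Mathlib

/-- The congruence on words generated by the equation `www = ww` (rewriting in any
context), i.e. the smallest equivalence relation with `u(www)v ∼ u(ww)v`. -/
inductive Sim {α : Type} : List α → List α → Prop where
  | base (u v w : List α) : Sim (u ++ (w ++ w ++ w) ++ v) (u ++ (w ++ w) ++ v)
  | refl (t : List α) : Sim t t
  | symm {s t : List α} : Sim s t → Sim t s
  | trans {s t u : List α} : Sim s t → Sim t u → Sim s u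

/-- A word is square-free if it contains no nonempty factor of the form `xx`. -/
def SqFree {α : Type} (w : List α) : Prop :=
  ¬ ∃ u x v : List α, x ≠ [] ∧ w = u ++ (x ++ x) ++ v

/-- The four-letter alphabet Σ' = Γ ∪ {0} with Γ = {a,b,c}. -/
inductive Letter4 : Type where
  | a | b | c | zero
deriving DecidableEq

/-- A letter of `Letter4` belongs to Γ = {a,b,c}. -/
def Letter4.isG : Letter4 → Prop := fun x => x ≠ Letter4.zero

/-- `K`: the closure of the language Γ*0Γ*0 under the congruence generated by
`xxx = xx`. -/
def Kset : Set (List Letter4) :=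
  {w | ∃ u v : List Letter4, (∀ x ∈ u, x.isG) ∧ (∀ x ∈ v, x.isG) ∧
    Sim w (u ++ [Letter4.zero] ++ v ++ [Letter4.zero])}

/-- A square-free word is `Sim`-equivalent only to itself. -/
theorem Sim.sqFree_iff_and_eq {α : Type} {s t : List α} (h : Sim s t) :
    (SqFree s ↔ SqFree t) ∧ (SqFree s → s = t) := by
  induction h with
  | base u v w =>
    by_cases hw : w = []
    · subst hw
      simp
    · have h₃ : ¬ SqFree (u ++ (w ++ w ++ w) ++ v) :=
        fun h => h ⟨u, w, w ++ v, hw, by simp⟩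
      have h₂ : ¬ SqFree (u ++ (w ++ w) ++ v) := fun h => h ⟨u, w, v, hw, rfl⟩
      tauto
  | refl t => simp
  | symm _ ih => exact ⟨ih.1.symm, fun h => (ih.2 (ih.1.2 h)).symm⟩
  | trans _ _ ih₁ ih₂ =>
    exact ⟨ih₁.1.trans ih₂.1, fun h => (ih₁.2 h).trans (ih₂.2 (ih₁.1.1 h))⟩

/-- The first `m` values of `f` form a square-free word if no two consecutive windows of the same
positive length `p` agree. -/
theorem sqFree_map_range {α : Type} (f : ℕ → α) (m : ℕ)
    (h : ∀ i p, 0 < p → i + 2 * p ≤ m → ¬ ∀ k < p, f (i + k) = f (i + p + k)) :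
    SqFree ((List.range m).map f) := by
  rintro ⟨u, x, v, hx, hw⟩
  have hlen := congrArg List.length hw
  simp only [List.length_map, List.length_range, List.length_append] at hlen
  refine h u.length x.length (List.length_pos_iff.2 hx) (by omega) fun k hk => ?_
  have h₁ := congrArg (fun l => l[u.length + k]?) hw
  have h₂ := congrArg (fun l => l[u.length + x.length + k]?) hw
  simp only [List.append_assoc] at h₁ h₂
  rw [List.getElem?_append_right (by omega), List.getElem?_append_left (by simp; omega)] at h₁
  rw [List.getElem?_append_right (by omega), List.getElem?_append_right (by omega),
    List.getElem?_append_left (by omega)] at h₂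
  rw [show u.length + k - u.length = k by omega, List.getElem?_map,
    List.getElem?_range (by omega)] at h₁
  rw [show u.length + x.length + k - u.length - x.length = k by omega, List.getElem?_map,
    List.getElem?_range (by omega)] at h₂
  exact Option.some_injective _ (h₁.trans h₂.symm)

/-- The Thue–Morse sequence: the parity of the binary digit sum. -/
def thueMorse (n : ℕ) : Bool := n.bits.foldr xor false

theorem thueMorse_two_mul (n : ℕ) : thueMorse (2 * n) = thueMorse n := by
  rcases eq_or_ne n 0 with rfl | hn
  · rfl
  · simp [thueMorse, Nat.bit0_bits n hn]

theorem thueMorse_two_mul_add_one (n : ℕ) : thueMorse (2 * n + 1) = !thueMorse n := by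
  simp [thueMorse]

/-- The Thue–Morse sequence contains no cube of a letter. -/
theorem thueMorse_not_const (i : ℕ) :
    ¬ (thueMorse i = thueMorse (i + 1) ∧ thueMorse (i + 1) = thueMorse (i + 2)) := by
  rintro ⟨h₁, h₂⟩
  rcases Nat.even_or_odd' i with ⟨m, rfl | rfl⟩
  · simp [thueMorse_two_mul, thueMorse_two_mul_add_one] at h₁
  · rw [show 2 * m + 1 + 1 = 2 * (m + 1) by ring, show 2 * m + 1 + 2 = 2 * (m + 1) + 1 by ring] at h₂
    simp [thueMorse_two_mul, thueMorse_two_mul_add_one] at h₂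

/-- If `thueMorse` agrees on `{n, n + 1}` and on its translate by an odd number `2 * q + 1`, then
the letters at the two halves around the odd one of `n` and `n + 2 * q + 1` are equal. -/
theorem thueMorse_eq_succ_of_odd_shift {n q : ℕ}
    (h₀ : thueMorse n = thueMorse (n + (2 * q + 1)))
    (h₁ : thueMorse (n + 1) = thueMorse (n + 1 + (2 * q + 1))) :
    (∀ m, n = 2 * m → thueMorse (m + q) = thueMorse (m + q + 1)) ∧
      ∀ m, n = 2 * m + 1 → thueMorse m = thueMorse (m + 1) := by
  constructor
  · rintro m rfl
    rw [show 2 * m + (2 * q + 1) = 2 * (m + q) + 1 by ring, thueMorse_two_mul,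
      thueMorse_two_mul_add_one] at h₀
    rw [show 2 * m + 1 + (2 * q + 1) = 2 * (m + q + 1) by ring, thueMorse_two_mul,
      thueMorse_two_mul_add_one] at h₁
    simp_all
  · rintro m rfl
    rw [show 2 * m + 1 + (2 * q + 1) = 2 * (m + q + 1) by ring, thueMorse_two_mul,
      thueMorse_two_mul_add_one] at h₀
    rw [show 2 * m + 1 + 1 + (2 * q + 1) = 2 * (m + q + 1) + 1 by ring,
      show 2 * m + 1 + 1 = 2 * (m + 1) by ring, thueMorse_two_mul,
      thueMorse_two_mul_add_one] at h₁
    rw [h₁, ← h₀, Bool.not_not]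

/-- The Thue–Morse sequence is overlap-free. -/
theorem thueMorse_overlap_free (p : ℕ) (hp : 0 < p) (i : ℕ) :
    ¬ ∀ k ≤ p, thueMorse (i + k) = thueMorse (i + k + p) := by
  induction p using Nat.strong_induction_on generalizing i with
  | _ p ih =>
    intro h
    rcases Nat.even_or_odd' p with ⟨q, rfl | rfl⟩
    · refine ih q (by omega) (by omega) (i / 2) fun k hk => ?_
      have h₂ := h (2 * k) (by omega)
      rcases Nat.even_or_odd' i with ⟨m, rfl | rfl⟩
      · rw [show 2 * m + 2 * k = 2 * (m + k) by ring, ← mul_add, thueMorse_two_mul,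
          thueMorse_two_mul] at h₂
        simpa using h₂
      · rw [show 2 * m + 1 + 2 * k + 2 * q = 2 * (m + k + q) + 1 by ring,
          show 2 * m + 1 + 2 * k = 2 * (m + k) + 1 by ring, thueMorse_two_mul_add_one,
          thueMorse_two_mul_add_one, Bool.not_inj_iff] at h₂
        rwa [show (2 * m + 1) / 2 = m by omega]
    · rcases Nat.eq_zero_or_pos q with rfl | hq
      · exact thueMorse_not_const i ⟨h 0 (by omega), h 1 (by omega)⟩
      · have h₀ := thueMorse_eq_succ_of_odd_shift (h 0 (by omega)) (h 1 (by omega))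
        have h₂ := thueMorse_eq_succ_of_odd_shift (h 2 (by omega)) (h 3 (by omega))
        rcases Nat.even_or_odd' i with ⟨m, rfl | rfl⟩
        · refine thueMorse_not_const (m + q) ⟨h₀.1 m rfl, ?_⟩
          have := h₂.1 (m + 1) (by ring)
          rwa [show m + 1 + q = m + q + 1 by ring] at this
        · exact thueMorse_not_const m ⟨h₀.2 m rfl, h₂.2 (m + 1) (by ring)⟩

/-- The ternary Thue word, recording the increments of the Thue–Morse sequence. -/
def ternaryThue (n : ℕ) : Letter4 :=
  match thueMorse n, thueMorse (n + 1) with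
  | false, true => Letter4.a
  | true, false => Letter4.b
  | _, _ => Letter4.c

theorem ternaryThue_ne_zero (n : ℕ) : ternaryThue n ≠ Letter4.zero := by
  unfold ternaryThue
  split <;> simp

theorem thueMorse_succ_of_ternaryThue_eq {m n : ℕ} (h : ternaryThue m = ternaryThue n) :
    (thueMorse m = thueMorse n → thueMorse (m + 1) = thueMorse (n + 1)) ∧
      (thueMorse m ≠ thueMorse n →
        thueMorse (m + 1) = thueMorse m ∧ thueMorse (n + 1) = thueMorse n) := by
  unfold ternaryThue at h
  cases hm : thueMorse m <;> cases hm' : thueMorse (m + 1) <;> cases hn : thueMorse n <;>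
    cases hn' : thueMorse (n + 1) <;> simp_all

/-- The ternary Thue word is square-free. -/
theorem ternaryThue_square_free (i p : ℕ) (hp : 0 < p) :
    ¬ ∀ k < p, ternaryThue (i + k) = ternaryThue (i + k + p) := by
  intro h
  by_cases h₀ : thueMorse i = thueMorse (i + p)
  · refine thueMorse_overlap_free p hp i fun k hk => ?_
    induction k with
    | zero => exact h₀
    | succ k ih =>
      have := (thueMorse_succ_of_ternaryThue_eq (h k hk)).1 (ih (by omega))
      rwa [show i + (k + 1) + p = i + k + p + 1 by ring]
  · have key : ∀ k ≤ p, thueMorse (i + k) = thueMorse i ∧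
        thueMorse (i + k + p) = thueMorse (i + p) := by
      intro k hk
      induction k with
      | zero => exact ⟨rfl, rfl⟩
      | succ k ih =>
        obtain ⟨h₁, h₂⟩ := ih (by omega)
        have := (thueMorse_succ_of_ternaryThue_eq (h k hk)).2 (by rwa [h₁, h₂])
        rw [show i + (k + 1) + p = i + k + p + 1 by ring, ← add_assoc]
        exact ⟨this.1.trans h₁, this.2.trans h₂⟩
    exact h₀ (key p le_rfl).1.symm

/-- The factor of length `n` of the ternary Thue word at position `i`. -/
def thueFactor (n i : ℕ) : List Letter4 := (List.range n).map fun r => ternaryThue (i + r)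

theorem isG_of_mem_thueFactor {n i : ℕ} {x : Letter4} (hx : x ∈ thueFactor n i) : x.isG := by
  obtain ⟨r, _, rfl⟩ := List.mem_map.1 hx
  exact ternaryThue_ne_zero _

theorem count_zero_eq_zero_of_isG {l : List Letter4} (h : ∀ x ∈ l, x.isG) :
    l.count Letter4.zero = 0 :=
  List.count_eq_zero.2 fun hz => h _ hz rfl

/-- The letter at position `j` of `v0w0v0`, where `v` and `w` are the factors of length `n` of the
ternary Thue word at positions `a` and `b`. -/
def interleaved (n a b j : ℕ) : Letter4 :=
  if j % (n + 1) = n then Letter4.zero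
  else ternaryThue ((if j / (n + 1) = 1 then b else a) + j % (n + 1))

theorem interleaved_eq_zero_iff {n a b j : ℕ} :
    interleaved n a b j = Letter4.zero ↔ j % (n + 1) = n := by
  unfold interleaved
  split_ifs <;> simp_all [ternaryThue_ne_zero]

theorem interleaved_of_lt {n a b q r : ℕ} (hr : r < n) :
    interleaved n a b ((n + 1) * q + r) = ternaryThue ((if q = 1 then b else a) + r) := by
  have h₁ : ((n + 1) * q + r) % (n + 1) = r := by
    rw [Nat.mul_add_mod, Nat.mod_eq_of_lt (by omega)]
  have h₂ : ((n + 1) * q + r) / (n + 1) = q := by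
    rw [Nat.mul_add_div (by omega), Nat.div_eq_of_lt (by omega), add_zero]
  rw [interleaved, h₁, h₂, if_neg hr.ne]

theorem map_interleaved_range (n a b : ℕ) :
    (List.range ((n + 1) * 3)).map (interleaved n a b) =
      (thueFactor n a ++ [Letter4.zero]) ++ (thueFactor n b ++ [Letter4.zero]) ++
        (thueFactor n a ++ [Letter4.zero]) := by
  have block : ∀ q, (List.range (n + 1)).map (fun r => interleaved n a b ((n + 1) * q + r)) =
      thueFactor n (if q = 1 then b else a) ++ [Letter4.zero] := by
    intro q
    rw [List.range_succ, List.map_append, List.map_singleton, thueFactor]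
    congr 1
    · exact List.map_congr_left fun r hr => interleaved_of_lt (List.mem_range.1 hr)
    · rw [interleaved_eq_zero_iff.2]
      rw [Nat.mul_add_mod, Nat.mod_eq_of_lt (by omega)]
  have h₀ := block 0
  have h₁ := block 1
  have h₂ := block 2
  simp only [mul_zero, zero_add, mul_one] at h₀ h₁ h₂
  rw [show (n + 1) * 3 = (n + 1) * 2 + (n + 1) by ring, List.range_add,
    show (n + 1) * 2 = (n + 1) + (n + 1) by ring, List.range_add]
  simp only [List.map_append, List.map_map, Function.comp_def]
  rw [show (n + 1) + (n + 1) = (n + 1) * 2 by ring, h₀, h₁, h₂]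
  rfl

/-- Distinct nearby positions carry distinct factors of length `n` of the ternary Thue word. -/
theorem exists_ternaryThue_ne {n a b : ℕ} (hab : a < b) (hb : b ≤ n) :
    ∃ r < n, ternaryThue (a + r) ≠ ternaryThue (b + r) := by
  by_contra! h
  refine ternaryThue_square_free a (b - a) (by omega) fun k hk => ?_
  rw [h k (by omega)]
  congr 1
  omega

theorem exists_mod_eq_of_le {n p : ℕ} (i : ℕ) (hp : n + 1 ≤ p) :
    ∃ k < p, (i + k) % (n + 1) = n := by
  have := Nat.mod_lt i (Nat.add_one_pos n)
  refine ⟨n - i % (n + 1), by omega, ?_⟩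
  rw [Nat.add_mod, Nat.mod_eq_of_lt (a := n - i % (n + 1)) (by omega),
    show i % (n + 1) + (n - i % (n + 1)) = n by omega, Nat.mod_eq_of_lt (by omega)]

/-- If `v ≠ w` are factors of the same length of the ternary Thue word then `v0w0v0` is
square-free. -/
theorem interleaved_square_free {n a b : ℕ} (hab : a < b) (hb : b ≤ n) (i p : ℕ) (hp : 0 < p)
    (hi : i + 2 * p ≤ (n + 1) * 3) :
    ¬ ∀ k < p, interleaved n a b (i + k) = interleaved n a b (i + p + k) := by
  intro h
  have hz : ∀ k < p, ((i + k) % (n + 1) = n ↔ (i + p + k) % (n + 1) = n) := fun k hk => by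
    rw [← interleaved_eq_zero_iff (a := a) (b := b), h k hk, interleaved_eq_zero_iff]
  have hdvd : ∀ k < p, (i + k) % (n + 1) = n → n + 1 ∣ p := fun k hk hk₀ => by
    have h₁ := (hz k hk).1 hk₀
    have h₂ : i + k ≡ i + p + k [MOD n + 1] := hk₀.trans h₁.symm
    have h₃ := (Nat.modEq_iff_dvd' (by omega)).1 h₂
    rwa [show i + p + k - (i + k) = p by omega] at h₃
  rcases Nat.lt_or_ge p (n + 1) with hlt | hge
  · have hnz : ∀ k < p, (i + k) % (n + 1) ≠ n := fun k hk hk₀ => by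
      have := Nat.le_of_dvd hp (hdvd k hk hk₀)
      omega
    have hnz' : ∀ k < 2 * p, (i + k) % (n + 1) ≠ n := fun k hk => by
      rcases Nat.lt_or_ge k p with hk' | hk'
      · exact hnz k hk'
      · have h₁ := hnz (k - p) (by omega)
        rw [Ne, hz (k - p) (by omega)] at h₁
        rwa [show i + p + (k - p) = i + k by omega] at h₁
    obtain ⟨q, r, hr, rfl⟩ : ∃ q r, r < n + 1 ∧ i = (n + 1) * q + r :=
      ⟨i / (n + 1), i % (n + 1), Nat.mod_lt _ n.succ_pos, (Nat.div_add_mod _ _).symm⟩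
    have hfit : r + 2 * p ≤ n := by
      by_contra! hc
      refine hnz' (n - r) (by omega) ?_
      rw [show (n + 1) * q + r + (n - r) = (n + 1) * q + n by omega, Nat.mul_add_mod,
        Nat.mod_eq_of_lt (by omega)]
    refine ternaryThue_square_free ((if q = 1 then b else a) + r) p hp fun k hk => ?_
    have h₁ := h k hk
    rw [show (n + 1) * q + r + p + k = (n + 1) * q + (r + k + p) by ring, add_assoc,
      interleaved_of_lt (by omega), interleaved_of_lt (by omega)] at h₁
    simpa only [add_assoc] using h₁
  · obtain ⟨k, hk, hk₀⟩ := exists_mod_eq_of_le i hge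
    obtain ⟨c, rfl⟩ := hdvd k hk hk₀
    have hc : c = 1 := by
      have : 0 < c := Nat.pos_of_mul_pos_left hp
      by_contra hne
      nlinarith [show 2 ≤ c by omega]
    subst hc
    obtain ⟨r, hr, hne⟩ := exists_ternaryThue_ne hab hb
    rcases Nat.lt_or_ge r i with hri | hri
    · have h₁ := h (n + 1 + r - i) (by omega)
      rw [show i + (n + 1 + r - i) = (n + 1) * 1 + r by omega,
        show i + (n + 1) * 1 + (n + 1 + r - i) = (n + 1) * 2 + r by omega,
        interleaved_of_lt hr, interleaved_of_lt hr] at h₁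
      exact hne (by simpa using h₁.symm)
    · have h₁ := h (r - i) (by omega)
      rw [show i + (r - i) = (n + 1) * 0 + r by omega,
        show i + (n + 1) * 1 + (r - i) = (n + 1) * 1 + r by omega,
        interleaved_of_lt hr, interleaved_of_lt hr] at h₁
      exact hne (by simpa using h₁)

theorem cube_mem_Kset (n a : ℕ) :
    (thueFactor n a ++ [Letter4.zero]) ++ (thueFactor n a ++ [Letter4.zero]) ++
      (thueFactor n a ++ [Letter4.zero]) ∈ Kset := by
  refine ⟨thueFactor n a, thueFactor n a, fun _ => isG_of_mem_thueFactor,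
    fun _ => isG_of_mem_thueFactor, ?_⟩
  simpa using Sim.base [] [] (thueFactor n a ++ [Letter4.zero])

theorem interleaved_notMem_Kset {n a b : ℕ} (hab : a < b) (hb : b ≤ n) :
    (thueFactor n a ++ [Letter4.zero]) ++ (thueFactor n b ++ [Letter4.zero]) ++
      (thueFactor n a ++ [Letter4.zero]) ∉ Kset := by
  rintro ⟨u, v, hu, hv, h⟩
  have hsq := sqFree_map_range _ _ (interleaved_square_free hab hb)
  rw [map_interleaved_range] at hsq
  have hcount := congrArg (List.count Letter4.zero) (h.sqFree_iff_and_eq.2 hsq)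
  simp [count_zero_eq_zero_of_isG hu, count_zero_eq_zero_of_isG hv,
    count_zero_eq_zero_of_isG fun _ => isG_of_mem_thueFactor] at hcount

/-- `K` is not a regular language (not recognized by any finite
deterministic automaton). -/
theorem Kset_not_regular :
    ¬ ∃ (Q : Type) (_ : Finite Q) (δ : Q → Letter4 → Q) (q₀ : Q) (F : Set Q),
      ∀ w : List Letter4, w ∈ Kset ↔ List.foldl δ q₀ w ∈ F := by
  rintro ⟨Q, _, δ, q₀, F, hF⟩
  set n := Nat.card (Q → Q)
  let act : Fin (n + 1) → Q → Q :=
    fun i q => List.foldl δ q (thueFactor n i ++ [Letter4.zero])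
  have hact : ¬ Function.Injective act := fun hinj => by
    have := Nat.card_le_card_of_injective act hinj
    rw [Nat.card_fin] at this
    omega
  obtain ⟨a, b, heq, hlt⟩ : ∃ a b, act a = act b ∧ a < b := by
    simp only [Function.Injective, not_forall] at hact
    obtain ⟨a, b, heq, hne⟩ := hact
    rcases lt_or_gt_of_ne hne with h | h
    · exact ⟨a, b, heq, h⟩
    · exact ⟨b, a, heq.symm, h⟩
  refine interleaved_notMem_Kset (n := n) hlt (Nat.lt_succ_iff.1 b.2) ((hF _).2 ?_)
  have hcube := (hF _).1 (cube_mem_Kset n a)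
  have hb := congrFun heq (List.foldl δ q₀ (thueFactor n a ++ [Letter4.zero]))
  simp only [act, List.foldl_append] at hb hcube ⊢
  rwa [← hb]
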